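/- Let β > 0 and define y : (0,∞) → ℝ by y(x) := √x · K(1/(β+2), (2/(β+2))·x^((β+2)/2)), where K(ν,z) := ∫₀^∞ exp(−z·cosh t)·cosh(ν·t) dt. Then, as x → 0 from the right, y(x) tends to (1/2)·Γ(1/(β+2))·(β+2)^(1/(β+2)) and y′(x) tends to −(1/2)·Γ((β+1)/(β+2))·(β+2)^((β+1)/(β+2)), where Γ is the real Gamma function. -/

import Mathlib

open Set Filter

/-- Modified Bessel function of the second kind (integral representation):
`K(ν, z) = ∫₀^∞ exp(−z cosh t) cosh(ν t) dt`. -/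
noncomputable def besselK (ν z : ℝ) : ℝ :=
  ∫ t in Set.Ioi (0 : ℝ), Real.exp (-z * Real.cosh t) * Real.cosh (ν * t)

/-- The decaying solution `y₊(x) = √x · K(1/(β+2), (2/(β+2)) x^((β+2)/2))` of the
anharmonic equation `−y″ + x^β y = 0` on `(0,∞)`. -/
noncomputable def yPlus (β x : ℝ) : ℝ :=
  Real.sqrt x * besselK (1 / (β + 2)) (2 / (β + 2) * x ^ ((β + 2) / 2))

/-- The two-sided exponential integral `∫₀^∞ u^(ν-1) exp(-u - w/u) du`, which equals `Γ(ν)` at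
`w = 0`. -/
noncomputable def incompleteBessel (ν w : ℝ) : ℝ :=
  ∫ u in Ioi (0 : ℝ), u ^ (ν - 1) * Real.exp (-u - w / u)

theorem aestronglyMeasurable_rpow_mul_exp (ν w : ℝ) :
    MeasureTheory.AEStronglyMeasurable (fun u : ℝ => u ^ (ν - 1) * Real.exp (-u - w / u))
      (MeasureTheory.volume.restrict (Ioi 0)) :=
  (by fun_prop : Measurable fun u : ℝ => u ^ (ν - 1) * Real.exp (-u - w / u)).aestronglyMeasurable

theorem norm_rpow_mul_exp_le (ν : ℝ) {w u : ℝ} (hw : 0 ≤ w) (hu : 0 < u) :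
    ‖u ^ (ν - 1) * Real.exp (-u - w / u)‖ ≤ Real.exp (-u) * u ^ (ν - 1) := by
  have hwu : 0 ≤ w / u := by positivity
  rw [Real.norm_of_nonneg (by positivity), mul_comm]
  gcongr
  linarith

theorem integrableOn_rpow_mul_exp {ν w : ℝ} (hν : 0 < ν) (hw : 0 ≤ w) :
    MeasureTheory.IntegrableOn (fun u : ℝ => u ^ (ν - 1) * Real.exp (-u - w / u)) (Ioi 0) := by
  refine (Real.GammaIntegral_convergent hν).mono' (aestronglyMeasurable_rpow_mul_exp ν w) ?_
  filter_upwards [MeasureTheory.ae_restrict_mem measurableSet_Ioi] with u hu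
  exact norm_rpow_mul_exp_le ν hw hu

theorem tendsto_incompleteBessel {ν : ℝ} (hν : 0 < ν) :
    Tendsto (incompleteBessel ν) (nhdsWithin 0 (Ioi 0)) (nhds (Real.Gamma ν)) := by
  rw [Real.Gamma_eq_integral hν]
  refine MeasureTheory.tendsto_integral_filter_of_dominated_convergence
    (fun u => Real.exp (-u) * u ^ (ν - 1))
    (Eventually.of_forall fun w => aestronglyMeasurable_rpow_mul_exp ν w) ?_
    (Real.GammaIntegral_convergent hν) ?_
  · filter_upwards [self_mem_nhdsWithin] with w hw
    filter_upwards [MeasureTheory.ae_restrict_mem measurableSet_Ioi] with u hu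
    exact norm_rpow_mul_exp_le ν (le_of_lt hw) hu
  · refine Eventually.of_forall fun u => ?_
    have h : Continuous fun w : ℝ => u ^ (ν - 1) * Real.exp (-u - w / u) := by fun_prop
    simpa [mul_comm] using (h.tendsto 0).mono_left (nhdsWithin_le_nhds (s := Ioi 0))

theorem hasDerivAt_incompleteBessel {ν w : ℝ} (hν : 0 < ν) (hw : 0 < w) :
    HasDerivAt (incompleteBessel ν) (-incompleteBessel (ν - 1) w) w := by
  have key := hasDerivAt_integral_of_dominated_loc_of_deriv_le
    (μ := MeasureTheory.volume.restrict (Ioi (0 : ℝ)))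
    (F := fun w u : ℝ => u ^ (ν - 1) * Real.exp (-u - w / u))
    (F' := fun w u : ℝ => -(u ^ (ν - 1 - 1) * Real.exp (-u - w / u)))
    (bound := fun u => (2 / w) * (Real.exp (-u) * u ^ (ν - 1)))
    (x₀ := w) (s := Ioi (w / 2)) (Ioi_mem_nhds (by linarith))
    (Eventually.of_forall fun w => aestronglyMeasurable_rpow_mul_exp ν w)
    (integrableOn_rpow_mul_exp hν hw.le)
    (aestronglyMeasurable_rpow_mul_exp (ν - 1) w).neg ?_
    ((Real.GammaIntegral_convergent hν).const_mul _) ?_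
  · have h := key.2
    rw [MeasureTheory.integral_neg] at h
    exact h
  · filter_upwards [MeasureTheory.ae_restrict_mem measurableSet_Ioi] with u hu v hv
    have hu : 0 < u := hu
    have hv : w / 2 < v := hv
    have hv0 : 0 < v := by linarith
    have hexp : Real.exp (-(v / u)) ≤ 2 / w * u := by
      have h1 : v / u ≤ Real.exp (v / u) := by linarith [Real.add_one_le_exp (v / u)]
      calc Real.exp (-(v / u)) = (Real.exp (v / u))⁻¹ := Real.exp_neg _
        _ ≤ (v / u)⁻¹ := inv_anti₀ (by positivity) h1
        _ = u / v := inv_div _ _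
        _ ≤ u / (w / 2) := by gcongr
        _ = 2 / w * u := by field_simp
    rw [norm_neg, Real.norm_of_nonneg (by positivity), sub_eq_add_neg (-u), Real.exp_add,
      Real.rpow_sub_one hu.ne' (ν - 1)]
    calc u ^ (ν - 1) / u * (Real.exp (-u) * Real.exp (-(v / u)))
        ≤ u ^ (ν - 1) / u * (Real.exp (-u) * (2 / w * u)) := by gcongr
      _ = 2 / w * (Real.exp (-u) * u ^ (ν - 1)) := by field_simp
  · filter_upwards [MeasureTheory.ae_restrict_mem measurableSet_Ioi] with u hu v _
    have hu : 0 < u := hu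
    have h1 : HasDerivAt (fun v : ℝ => -u - v / u) (-(1 / u)) v :=
      ((hasDerivAt_id v).div_const u).const_sub (-u)
    refine (h1.exp.const_mul (u ^ (ν - 1))).congr_deriv ?_
    rw [Real.rpow_sub_one hu.ne' (ν - 1)]
    ring

theorem incompleteBessel_neg (ν : ℝ) {w : ℝ} (hw : 0 < w) :
    incompleteBessel (-ν) w = w ^ (-ν) * incompleteBessel ν w := by
  have himage : (fun u : ℝ => w / u) '' Ioi 0 = Ioi 0 := by
    ext u
    constructor
    · rintro ⟨v, hv, rfl⟩
      exact div_pos hw hv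
    · exact fun hu => ⟨w / u, div_pos hw hu, div_div_cancel₀ hw.ne'⟩
  have key := MeasureTheory.integral_image_eq_integral_abs_deriv_smul
    (s := Ioi (0 : ℝ)) (f := fun u : ℝ => w / u) (f' := fun u => -w / u ^ 2) measurableSet_Ioi
    (fun u hu => ?_) (fun u hu v hv h => ?_)
    (fun u : ℝ => u ^ (-ν - 1) * Real.exp (-u - w / u))
  · rw [himage] at key
    rw [incompleteBessel, key, incompleteBessel, ← MeasureTheory.integral_const_mul]
    refine MeasureTheory.setIntegral_congr_fun measurableSet_Ioi fun u hu => ?_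
    have hu : 0 < u := hu
    have habs : |-w / u ^ 2| = w / u ^ 2 := by
      rw [neg_div, abs_neg, abs_of_pos (by positivity)]
    simp only [smul_eq_mul]
    rw [habs, div_div_cancel₀ hw.ne', Real.rpow_sub_one (by positivity), Real.rpow_sub_one hu.ne',
      Real.div_rpow hw.le hu.le, Real.rpow_neg hu.le,
      show -(w / u) - u = -u - w / u by ring]
    field_simp
  · exact (((hasDerivAt_const u w).div (hasDerivAt_id u) (ne_of_gt hu)).congr_deriv
      (by simp)).hasDerivWithinAt
  · have hu : 0 < u := hu
    have hv : 0 < v := hv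
    rw [div_eq_div_iff hu.ne' hv.ne'] at h
    exact (mul_left_cancel₀ hw.ne' h).symm

theorem besselK_eq_incompleteBessel {ν z : ℝ} (hν : 0 < ν) (hz : 0 < z) :
    besselK ν z = 1 / 2 * (z / 2) ^ (-ν) * incompleteBessel ν ((z / 2) ^ 2) := by
  set c := z / 2 with hc
  have hc0 : 0 < c := by positivity
  have himage : (fun t : ℝ => c * Real.exp t) '' univ = Ioi 0 := by
    ext u
    constructor
    · rintro ⟨t, -, rfl⟩
      exact mul_pos hc0 (Real.exp_pos t)
    · intro hu
      refine ⟨Real.log (u / c), mem_univ _, ?_⟩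
      simp only [Real.exp_log (div_pos hu hc0)]
      exact mul_div_cancel₀ u hc0.ne'
  have hderiv : ∀ t ∈ (univ : Set ℝ),
      HasDerivWithinAt (fun t : ℝ => c * Real.exp t) (c * Real.exp t) univ t :=
    fun t _ => ((Real.hasDerivAt_exp t).const_mul c).hasDerivWithinAt
  have hinj : InjOn (fun t : ℝ => c * Real.exp t) univ :=
    fun s _ t _ h => Real.exp_injective (mul_left_cancel₀ hc0.ne' h)
  have hfun : ∀ t : ℝ, |c * Real.exp t| • ((c * Real.exp t) ^ (ν - 1) *
      Real.exp (-(c * Real.exp t) - c ^ 2 / (c * Real.exp t))) =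
      c ^ ν * (Real.exp (-z * Real.cosh t) * Real.exp (ν * t)) := by
    intro t
    have hpos : 0 < c * Real.exp t := by positivity
    have harg : -(c * Real.exp t) - c ^ 2 / (c * Real.exp t) = -z * Real.cosh t := by
      rw [Real.cosh_eq, Real.exp_neg, hc]
      field_simp
      ring
    rw [abs_of_pos hpos, harg, Real.rpow_sub_one hpos.ne', Real.mul_rpow hc0.le (Real.exp_pos t).le,
      ← Real.exp_mul, mul_comm t ν, smul_eq_mul]
    field_simp
  have hG : incompleteBessel ν (c ^ 2) =
      c ^ ν * ∫ t : ℝ, Real.exp (-z * Real.cosh t) * Real.exp (ν * t) := by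
    rw [incompleteBessel, ← himage, MeasureTheory.integral_image_eq_integral_abs_deriv_smul
      MeasurableSet.univ hderiv hinj, MeasureTheory.setIntegral_univ,
      ← MeasureTheory.integral_const_mul]
    simp only [hfun]
  have hint : MeasureTheory.Integrable
      fun t : ℝ => Real.exp (-z * Real.cosh t) * Real.exp (ν * t) := by
    have h := integrableOn_rpow_mul_exp hν (sq_nonneg c)
    rw [← himage, MeasureTheory.integrableOn_image_iff_integrableOn_abs_deriv_smul
      MeasurableSet.univ hderiv hinj, MeasureTheory.integrableOn_univ] at h
    simp only [hfun] at h
    exact (MeasureTheory.integrable_const_mul_iff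
      (isUnit_iff_ne_zero.mpr (Real.rpow_pos_of_pos hc0 ν).ne') _).mp h
  have hK : 2 * besselK ν z = ∫ t : ℝ, Real.exp (-z * Real.cosh t) * Real.exp (ν * t) := by
    have heven : ∀ t : ℝ, Real.exp (-z * Real.cosh |t|) * Real.cosh (ν * |t|) =
        1 / 2 * (Real.exp (-z * Real.cosh t) * Real.exp (ν * t)) +
        1 / 2 * (Real.exp (-z * Real.cosh (-t)) * Real.exp (ν * -t)) := by
      intro t
      have h : Real.cosh (ν * |t|) = Real.cosh (ν * t) := by
        rcases abs_choice t with h | h <;> simp [h]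
      rw [h, Real.cosh_abs, Real.cosh_neg, Real.cosh_eq (ν * t), mul_neg]
      ring
    rw [besselK, ← integral_comp_abs
      (f := fun t => Real.exp (-z * Real.cosh t) * Real.cosh (ν * t))]
    simp only [heven]
    rw [MeasureTheory.integral_add (hint.const_mul _) (hint.comp_neg.const_mul _),
      MeasureTheory.integral_const_mul, MeasureTheory.integral_const_mul,
      MeasureTheory.integral_neg_eq_self
        (fun t : ℝ => Real.exp (-z * Real.cosh t) * Real.exp (ν * t))]
    ring
  rw [hG, ← hK, Real.rpow_neg hc0.le]
  field_simp

theorem yPlus_eq_incompleteBessel {β x : ℝ} (hβ : 0 < β + 2) (hx : 0 < x) :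
    yPlus β x = 1 / 2 * (β + 2) ^ (1 / (β + 2)) *
      incompleteBessel (1 / (β + 2)) (x ^ (β + 2) / (β + 2) ^ 2) := by
  have hhalf : 2 / (β + 2) * x ^ ((β + 2) / 2) / 2 = x ^ ((β + 2) / 2) / (β + 2) := by
    field_simp
  have hsq : (x ^ ((β + 2) / 2) / (β + 2)) ^ 2 = x ^ (β + 2) / (β + 2) ^ 2 := by
    rw [div_pow, ← Real.rpow_mul_natCast hx.le]
    norm_num
  have hpow : (x ^ ((β + 2) / 2) / (β + 2)) ^ (-(1 / (β + 2))) =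
      (Real.sqrt x)⁻¹ * (β + 2) ^ (1 / (β + 2)) := by
    rw [Real.rpow_neg (by positivity), Real.div_rpow (by positivity) hβ.le,
      ← Real.rpow_mul hx.le, show (β + 2) / 2 * (1 / (β + 2)) = 1 / 2 by field_simp,
      ← Real.sqrt_eq_rpow, inv_div, div_eq_inv_mul]
  have hs : Real.sqrt x ≠ 0 := (Real.sqrt_pos.mpr hx).ne'
  rw [yPlus, besselK_eq_incompleteBessel (by positivity) (by positivity), hhalf, hsq, hpow]
  field_simp

theorem deriv_yPlus {β x : ℝ} (hβ : 0 < β + 2) (hx : 0 < x) :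
    deriv (yPlus β) x = -(1 / 2 * (β + 2) ^ ((β + 1) / (β + 2)) *
      incompleteBessel ((β + 1) / (β + 2)) (x ^ (β + 2) / (β + 2) ^ 2)) := by
  have heq : yPlus β =ᶠ[nhds x] fun x => 1 / 2 * (β + 2) ^ (1 / (β + 2)) *
      incompleteBessel (1 / (β + 2)) (x ^ (β + 2) / (β + 2) ^ 2) := by
    filter_upwards [Ioi_mem_nhds hx] with v hv
    exact yPlus_eq_incompleteBessel hβ hv
  have hw : 0 < x ^ (β + 2) / (β + 2) ^ 2 := by positivity
  have hpow : HasDerivAt (fun x : ℝ => x ^ (β + 2) / (β + 2) ^ 2)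
      ((β + 2) * x ^ (β + 2 - 1) / (β + 2) ^ 2) x :=
    (Real.hasDerivAt_rpow_const (Or.inl hx.ne')).div_const _
  have hder := (((hasDerivAt_incompleteBessel (ν := 1 / (β + 2)) (by positivity) hw).comp x
    hpow).const_mul (1 / 2 * (β + 2) ^ (1 / (β + 2))))
  have hν : (1 : ℝ) / (β + 2) - 1 = -((β + 1) / (β + 2)) := by
    field_simp
    ring
  have hone : (1 : ℝ) / (β + 2) = 1 - (β + 1) / (β + 2) := by linarith
  have hx1 : (x ^ (β + 2)) ^ ((β + 1) / (β + 2)) = x ^ (β + 1) := by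
    rw [← Real.rpow_mul hx.le, mul_div_cancel₀ _ hβ.ne']
  have hb : ((β + 2) ^ 2) ^ ((β + 1) / (β + 2)) = ((β + 2) ^ ((β + 1) / (β + 2))) ^ 2 := by
    rw [← Real.rpow_natCast_mul hβ.le, ← Real.rpow_mul_natCast hβ.le, mul_comm]
  rw [heq.deriv_eq]
  refine hder.deriv.trans ?_
  rw [hν, incompleteBessel_neg _ hw, Real.rpow_neg hw.le, Real.div_rpow (by positivity)
    (by positivity), hx1, hb, hone, Real.rpow_sub hβ, Real.rpow_one,
    show β + 2 - 1 = β + 1 by ring]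
  have hx2 : 0 < x ^ (β + 1) := by positivity
  have hb2 : 0 < (β + 2) ^ ((β + 1) / (β + 2)) := by positivity
  generalize (β + 2) ^ ((β + 1) / (β + 2)) = b at *
  field_simp

/-- boundary values at the origin: as `x → 0⁺`,
`y(x) → (1/2) Γ(1/(β+2)) (β+2)^(1/(β+2))` and
`y′(x) → −(1/2) Γ((β+1)/(β+2)) (β+2)^((β+1)/(β+2))`. -/
theorem stmt8 (β : ℝ) (hβ : 0 < β) :
    Tendsto (fun x : ℝ => yPlus β x) (nhdsWithin 0 (Ioi (0 : ℝ)))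
      (nhds ((1 / 2) * Real.Gamma (1 / (β + 2)) * (β + 2) ^ (1 / (β + 2)))) ∧
    Tendsto (fun x : ℝ => deriv (yPlus β) x) (nhdsWithin 0 (Ioi (0 : ℝ)))
      (nhds (-((1 / 2) * Real.Gamma ((β + 1) / (β + 2)) *
        (β + 2) ^ ((β + 1) / (β + 2))))) := by
  have hw : Tendsto (fun x : ℝ => x ^ (β + 2) / (β + 2) ^ 2) (nhdsWithin 0 (Ioi 0))
      (nhdsWithin 0 (Ioi 0)) := by
    refine tendsto_nhdsWithin_iff.mpr ⟨?_, ?_⟩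
    · have h : Continuous fun x : ℝ => x ^ (β + 2) / (β + 2) ^ 2 :=
        (Real.continuous_rpow_const (by linarith)).div_const _
      have h0 := (h.tendsto 0).mono_left (nhdsWithin_le_nhds (s := Ioi 0))
      rwa [Real.zero_rpow (by linarith), zero_div] at h0
    · filter_upwards [self_mem_nhdsWithin] with x hx
      have hx : 0 < x := hx
      exact mem_Ioi.mpr (by positivity)
  constructor
  · have h := ((tendsto_incompleteBessel (ν := 1 / (β + 2)) (by positivity)).comp hw).const_mul
      (1 / 2 * (β + 2) ^ (1 / (β + 2)))
    rw [mul_right_comm]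
    refine h.congr' ?_
    filter_upwards [self_mem_nhdsWithin] with x hx
    exact (yPlus_eq_incompleteBessel (by linarith) hx).symm
  · have h := (((tendsto_incompleteBessel (ν := (β + 1) / (β + 2)) (by positivity)).comp
      hw).const_mul (1 / 2 * (β + 2) ^ ((β + 1) / (β + 2)))).neg
    rw [mul_right_comm (1 / 2 : ℝ)]
    refine h.congr' ?_
    filter_upwards [self_mem_nhdsWithin] with x hx
    exact (deriv_yPlus (by linarith) hx).symm
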